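/- Fix a positive integer m. For every ε > 0 there exists a constant C = C(m, ε) such that for every positive integer n and every integer 1 ≤ k ≤ mn, |Pr[f(π̄) = k] − e^{−k/n}/n| ≤ ε/n + C/n², where π̄ is a uniformly random element of S_{m,n}. -/

import Mathlib

open Finset

/-- `DeckSet m n` : words of length `m*n` over alphabet `Fin n` (symbol `i` models card
type `i+1`) in which every symbol occurs exactly `m` times. -/
def DeckSet (m n : ℕ) : Finset (Fin (m * n) → Fin n) :=
  Finset.univ.filter fun π => ∀ v : Fin n, (Finset.univ.filter fun t => π t = v).card = m

/-- Feedback history: `feedback G π t` is the list of Yes/No bits received after the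
first `t` guesses when playing strategy `G` against deck `π`. -/
def feedback {n N : ℕ} (G : List Bool → Fin n) (π : Fin N → Fin n) : ℕ → List Bool
  | 0 => []
  | t + 1 =>
      feedback G π t ++
        [if h : t < N then decide (G (feedback G π t) = π ⟨t, h⟩) else false]

/-- Score of the deterministic Yes/No-feedback strategy `G` against the deck `π`:
the number of positions `t` where the guess `G (feedback G π t)` equals `π t`. -/
def guessScore {n N : ℕ} (G : List Bool → Fin n) (π : Fin N → Fin n) : ℕ :=
  (Finset.univ.filter fun t : Fin N => G (feedback G π t.1) = π t).card

/-- Score of the avoiding strategy on deck `π` (0-indexed positions, symbol `i : Fin n`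
models card type `i+1`): guess `1, 2, …, n, 1, 2, …` (i.e. symbol `t % n` at time `t`)
until the first correct guess, at position `f`; thereafter guess `π f` forever.  The
score is `0` if no guess in the first phase is ever correct, and otherwise
`1 + #{s : f < s, π s = π f}`. -/
def avoidScore (m n : ℕ) (π : Fin (m * n) → Fin n) : ℕ :=
  if h : (Finset.univ.filter fun t : Fin (m * n) => (π t).1 = t.1 % n).Nonempty then
    1 + (Finset.univ.filter fun s : Fin (m * n) =>
        (Finset.univ.filter fun t : Fin (m * n) => (π t).1 = t.1 % n).min' h < s ∧
        π s = π ((Finset.univ.filter fun t : Fin (m * n) => (π t).1 = t.1 % n).min' h)).card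
  else 0

/-- `firstHit m n π` is the 1-indexed position of the first correct guess made by the
avoiding strategy on deck `π` (i.e. the least `t` with `π_t = ((t-1) mod n) + 1`),
and `0` if there is none (`f(π) = ∞`). -/
def firstHit (m n : ℕ) (π : Fin (m * n) → Fin n) : ℕ :=
  if h : (Finset.univ.filter fun t : Fin (m * n) => (π t).1 = t.1 % n).Nonempty then
    ((Finset.univ.filter fun t : Fin (m * n) => (π t).1 = t.1 % n).min' h).1 + 1
  else 0

lemma modNat_mem_DeckSet (m n : ℕ) : (Fin.modNat : Fin (m * n) → Fin n) ∈ DeckSet m n := by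
  simp only [DeckSet, mem_filter, mem_univ, true_and]
  intro v
  have h : (univ.filter fun t : Fin (m * n) => t.modNat = v) =
      univ.image fun i : Fin m => finProdFinEquiv (i, v) := by
    ext t
    obtain ⟨⟨i, w⟩, rfl⟩ := finProdFinEquiv.surjective t
    have hw : (finProdFinEquiv (i, w)).modNat = w :=
      congrArg Prod.snd (finProdFinEquiv.symm_apply_apply (i, w))
    simp [hw, eq_comm]
  rw [h, card_image_of_injective _ fun i j hij => by simpa using hij, card_univ, Fintype.card_fin]

lemma comp_perm_mem_DeckSet {m n : ℕ} (τ : Equiv.Perm (Fin (m * n))) {π : Fin (m * n) → Fin n}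
    (hπ : π ∈ DeckSet m n) : π ∘ τ ∈ DeckSet m n := by
  simp only [DeckSet, mem_filter, mem_univ, true_and] at hπ ⊢
  intro v
  exact (card_equiv τ (by simp)).trans (hπ v)

lemma perm_comp_mem_DeckSet {m n : ℕ} (e : Equiv.Perm (Fin n)) {π : Fin (m * n) → Fin n}
    (hπ : π ∈ DeckSet m n) : e ∘ π ∈ DeckSet m n := by
  simp only [DeckSet, mem_filter, mem_univ, true_and] at hπ ⊢
  intro v
  simpa [Equiv.eq_symm_apply] using hπ (e.symm v)

/-- The decks with prescribed card `v` at position `s` make up a proportion `1 / n`. -/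
lemma card_filter_apply_eq {m n : ℕ} (s : Fin (m * n)) (v : Fin n) :
    n * ((DeckSet m n).filter fun π => π s = v).card = (DeckSet m n).card := by
  have h : ∀ w : Fin n, ((DeckSet m n).filter fun π => π s = w).card =
      ((DeckSet m n).filter fun π => π s = v).card := by
    intro w
    refine card_nbij' (fun π => Equiv.swap v w ∘ π) (fun π => Equiv.swap v w ∘ π) ?_ ?_ ?_ ?_
    · intro π hπ
      simp only [coe_filter, Set.mem_ofPred_eq] at hπ ⊢
      exact ⟨perm_comp_mem_DeckSet _ hπ.1, by simp [hπ.2]⟩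
    · intro π hπ
      simp only [coe_filter, Set.mem_ofPred_eq] at hπ ⊢
      exact ⟨perm_comp_mem_DeckSet _ hπ.1, by simp [hπ.2]⟩
    · intro π _; ext; simp
    · intro π _; ext; simp
  rw [card_eq_sum_card_fiberwise (s := DeckSet m n) (f := fun π => π s) (t := univ) (by simp),
    sum_congr rfl fun w _ => h w]
  simp

/-- Decks with two distinct cards prescribed at positions `s` and `t`. -/
lemma card_filter_apply_eq_and_le {m n : ℕ} (s t : Fin (m * n)) {v w : Fin n} (hvw : w ≠ v) :
    (n - 1) * ((DeckSet m n).filter fun π => π s = v ∧ π t = w).card ≤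
      ((DeckSet m n).filter fun π => π s = v).card := by
  have h : ∀ u ∈ univ.erase v, ((DeckSet m n).filter fun π => π s = v ∧ π t = w).card ≤
      (((DeckSet m n).filter fun π => π s = v).filter fun π => π t = u).card := by
    intro u hu
    have hu : u ≠ v := by simpa using hu
    refine card_le_card_of_injOn (fun π => Equiv.swap w u ∘ π) ?_ ?_
    · intro π hπ
      simp only [coe_filter, Set.mem_ofPred_eq, mem_filter] at hπ ⊢
      exact ⟨⟨perm_comp_mem_DeckSet _ hπ.1, by
        simp [hπ.2.1, Equiv.swap_apply_of_ne_of_ne hvw.symm hu.symm]⟩, by simp [hπ.2.2]⟩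
    · intro π _ ρ _ hπρ
      exact (Equiv.swap w u).injective.comp_left hπρ
  calc (n - 1) * ((DeckSet m n).filter fun π => π s = v ∧ π t = w).card
      = ∑ u ∈ univ.erase v, ((DeckSet m n).filter fun π => π s = v ∧ π t = w).card := by simp
    _ ≤ ∑ u ∈ univ.erase v,
        (((DeckSet m n).filter fun π => π s = v).filter fun π => π t = u).card := sum_le_sum h
    _ ≤ ∑ u, (((DeckSet m n).filter fun π => π s = v).filter fun π => π t = u).card :=
        sum_le_sum_of_subset (erase_subset _ _)
    _ = _ := (card_eq_sum_card_fiberwise (by simp)).symm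

/-- The decks on which none of the first `k` guesses of the avoiding strategy is correct. -/
def noHitBefore (m n k : ℕ) : Finset (Fin (m * n) → Fin n) :=
  (DeckSet m n).filter fun π => ∀ t : Fin (m * n), t.1 < k → π t ≠ t.modNat

lemma firstHit_eq_succ_iff {m n : ℕ} (π : Fin (m * n) → Fin n) (K : Fin (m * n)) :
    firstHit m n π = K.1 + 1 ↔ π K = K.modNat ∧ ∀ t : Fin (m * n), t.1 < K.1 → π t ≠ t.modNat := by
  have hg : ∀ t : Fin (m * n), (π t).1 = t.1 % n ↔ π t = t.modNat := fun t => by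
    simp [Fin.ext_iff]
  unfold firstHit
  simp only [hg]
  split_ifs with h
  · rw [add_left_inj, ← Fin.ext_iff, min'_eq_iff]
    simp only [mem_filter, mem_univ, true_and]
    refine and_congr_right fun _ => forall_congr' fun t => ?_
    rw [← Fin.lt_def]
    exact ⟨fun h1 h2 h3 => absurd (h1 h3) (not_le.2 h2), fun h1 h2 => not_lt.1 fun h3 => h1 h3 h2⟩
  · exact ⟨fun h' => by simp at h', fun h' => absurd ⟨K, by simpa using h'.1⟩ h⟩

lemma filter_firstHit_eq_succ {m n : ℕ} (K : Fin (m * n)) :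
    ((DeckSet m n).filter fun π => firstHit m n π = K.1 + 1) =
      (noHitBefore m n K).filter fun π => π K = K.modNat := by
  ext π
  simp only [firstHit_eq_succ_iff, noHitBefore, mem_filter]
  tauto

lemma card_noHitBefore {m n : ℕ} (K : Fin (m * n)) :
    (noHitBefore m n K).card = ((noHitBefore m n K).filter fun π => π K = K.modNat).card +
      (noHitBefore m n (K + 1)).card := by
  rw [← card_filter_add_card_filter_not (fun π : Fin (m * n) → Fin n => π K = K.modNat)]
  congr 2
  ext π
  simp only [noHitBefore, mem_filter, Nat.lt_succ_iff_lt_or_eq, ← Fin.ext_iff]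
  constructor
  · rintro ⟨⟨h1, h2⟩, h3⟩
    refine ⟨h1, ?_⟩
    rintro t (ht | rfl)
    exacts [h2 t ht, h3]
  · rintro ⟨h1, h2⟩
    exact ⟨⟨h1, fun t ht => h2 t (.inl ht)⟩, h2 K (.inr rfl)⟩

lemma sum_card_filter_apply_eq {m n : ℕ} {B : Finset (Fin (m * n) → Fin n)}
    (hB : B ⊆ DeckSet m n) (v : Fin n) :
    ∑ s, (B.filter fun π => π s = v).card = m * B.card := by
  simp only [card_filter]
  rw [sum_comm]
  simp only [← card_filter]
  rw [sum_congr rfl fun π hπ => (mem_filter.1 (hB hπ)).2 v]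
  simp [mul_comm]

lemma noHitBefore_subset (m n k : ℕ) : noHitBefore m n k ⊆ DeckSet m n := filter_subset _ _

lemma card_noHitBefore_filter_le {m n : ℕ} (K s : Fin (m * n)) :
    ((noHitBefore m n K).filter fun π => π s = K.modNat).card ≤
      ((noHitBefore m n K).filter fun π => π K = K.modNat).card +
      ((DeckSet m n).filter fun π => π s = K.modNat ∧ π K = s.modNat).card := by
  rw [← card_filter_add_card_filter_not (s := (noHitBefore m n K).filter fun π => π s = K.modNat)
    (fun π : Fin (m * n) → Fin n => π K = s.modNat), add_comm]
  refine Nat.add_le_add ?_ (card_le_card ?_)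
  · refine card_le_card_of_injOn (fun π => π ∘ Equiv.swap K s) ?_ ?_
    · intro π hπ
      simp only [noHitBefore, coe_filter, Set.mem_ofPred_eq, mem_filter] at hπ ⊢
      obtain ⟨⟨⟨h1, h2⟩, h3⟩, h4⟩ := hπ
      refine ⟨⟨comp_perm_mem_DeckSet _ h1, fun t ht => ?_⟩, by simpa using h3⟩
      have htK : t ≠ K := by rintro rfl; exact lt_irrefl _ ht
      by_cases hts : t = s
      · simpa [hts] using h4
      · simpa [Equiv.swap_apply_of_ne_of_ne htK hts] using h2 t ht
    · intro π _ ρ _ h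
      exact (Equiv.swap K s).surjective.injective_comp_right h
  · intro π
    simp only [noHitBefore, mem_filter]
    tauto

lemma card_filter_le_card_noHitBefore_filter {m n : ℕ} (K s : Fin (m * n)) :
    ((noHitBefore m n K).filter fun π => π K = K.modNat).card ≤
      ((noHitBefore m n K).filter fun π => π s = K.modNat).card +
      if s.modNat = K.modNat then ((DeckSet m n).filter fun π => π K = K.modNat).card else 0 := by
  split_ifs with hs
  · exact (card_le_card (filter_subset_filter _ (noHitBefore_subset m n K))).trans (by omega)
  · refine card_le_card_of_injOn (fun π => π ∘ Equiv.swap K s) ?_ ?_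
    · intro π hπ
      simp only [noHitBefore, coe_filter, Set.mem_ofPred_eq, mem_filter] at hπ ⊢
      obtain ⟨⟨h1, h2⟩, h3⟩ := hπ
      refine ⟨⟨comp_perm_mem_DeckSet _ h1, fun t ht => ?_⟩, by simpa using h3⟩
      have htK : t ≠ K := by rintro rfl; exact lt_irrefl _ ht
      by_cases hts : t = s
      · simpa [hts, h3] using Ne.symm hs
      · simpa [Equiv.swap_apply_of_ne_of_ne htK hts] using h2 t ht
    · intro π _ ρ _ h
      exact (Equiv.swap K s).surjective.injective_comp_right h

lemma sum_ite_modNat_eq {m n : ℕ} (v : Fin n) (c : ℝ) :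
    ∑ s : Fin (m * n), (if s.modNat = v then c else 0) = m * c := by
  rw [← sum_filter, sum_const, (mem_filter.1 (modNat_mem_DeckSet m n)).2 v, nsmul_eq_mul]

/-- Given no hit among the earlier guesses, the next guess is correct with probability close to
`1 / n`. -/
lemma abs_card_noHitBefore_sub_le {m n : ℕ} (hm : 0 < m) (hn : 2 ≤ n) (K : Fin (m * n)) :
    |((noHitBefore m n K).card : ℝ) -
      n * ((noHitBefore m n K).filter fun π => π K = K.modNat).card| ≤
      3 * (DeckSet m n).card / n := by
  have hn' : (2 : ℝ) ≤ n := by exact_mod_cast hn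
  have hm' : (0 : ℝ) < m := by exact_mod_cast hm
  set N : ℝ := ((DeckSet m n).card : ℝ) with hN
  set B := noHitBefore m n K with hB
  set a : ℝ := ((B.filter fun π => π K = K.modNat).card : ℝ) with ha
  have hN0 : 0 ≤ N := Nat.cast_nonneg _
  have hone : ∀ s v, (((DeckSet m n).filter fun π => π s = v).card : ℝ) = N / n := by
    intro s v
    rw [eq_div_iff (by positivity), mul_comm, hN]
    exact_mod_cast card_filter_apply_eq s v
  have hpair : ∀ s, (((DeckSet m n).filter fun π => π s = K.modNat ∧ π K = s.modNat).card : ℝ) ≤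
      2 * N / n ^ 2 + if s.modNat = K.modNat then N / n else 0 := by
    intro s
    split_ifs with hs
    · rw [← hone K s.modNat]
      have : (((DeckSet m n).filter fun π => π s = K.modNat ∧ π K = s.modNat).card : ℝ) ≤
          ((DeckSet m n).filter fun π => π K = s.modNat).card := by
        exact_mod_cast card_le_card (show ((DeckSet m n).filter fun π =>
            π s = K.modNat ∧ π K = s.modNat) ⊆ (DeckSet m n).filter fun π => π K = s.modNat from
              fun π hπ => by simp only [mem_filter] at hπ ⊢; exact ⟨hπ.1, hπ.2.2⟩)
      have : 0 ≤ 2 * N / n ^ 2 := by positivity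
      linarith
    · have h := card_filter_apply_eq_and_le s K hs
      have h' : ((n : ℝ) - 1) *
          ((DeckSet m n).filter fun π => π s = K.modNat ∧ π K = s.modNat).card ≤ N / n := by
        rw [← hone s K.modNat, ← Nat.cast_one, ← Nat.cast_sub (by omega)]
        exact_mod_cast h
      set x : ℝ := (((DeckSet m n).filter fun π => π s = K.modNat ∧ π K = s.modNat).card : ℝ)
      have hx : 0 ≤ x := Nat.cast_nonneg _
      have : n / 2 * x ≤ N / n := le_trans (by gcongr; linarith) h'
      rw [add_zero, le_div_iff₀ (by positivity)]
      rw [le_div_iff₀ (by positivity)] at this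
      linarith
  have hsum : ∑ s, ((B.filter fun π => π s = K.modNat).card : ℝ) = m * B.card := by
    exact_mod_cast sum_card_filter_apply_eq (noHitBefore_subset m n K) K.modNat
  have hconst : ∀ c : ℝ, ∑ _s : Fin (m * n), c = m * n * c := by simp
  have upper : m * (B.card : ℝ) ≤ m * (n * a + 3 * N / n) := by
    calc m * (B.card : ℝ) = ∑ s, ((B.filter fun π => π s = K.modNat).card : ℝ) := hsum.symm
      _ ≤ ∑ s : Fin (m * n), (a + (2 * N / n ^ 2 + if s.modNat = K.modNat then N / n else 0)) := by
        refine sum_le_sum fun s _ => le_trans ?_ (add_le_add_right (hpair s) a)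
        rw [ha, hB]
        exact_mod_cast card_noHitBefore_filter_le K s
      _ = m * (n * a + 3 * N / n) := by
        rw [sum_add_distrib, sum_add_distrib, hconst, hconst, sum_ite_modNat_eq]
        field_simp
        ring
  have lower : m * (n * a) ≤ m * (B.card + N / n) := by
    calc m * (n * a) = ∑ _s : Fin (m * n), a := by rw [hconst]; ring
      _ ≤ ∑ s : Fin (m * n), (((B.filter fun π => π s = K.modNat).card : ℝ) +
          if s.modNat = K.modNat then N / n else 0) := by
        refine sum_le_sum fun s _ => ?_
        rw [← hone K K.modNat, ha, hB]
        exact_mod_cast card_filter_le_card_noHitBefore_filter K s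
      _ = m * (B.card + N / n) := by
        rw [sum_add_distrib, hsum, sum_ite_modNat_eq]
        ring
  have upper := le_of_mul_le_mul_left upper hm'
  have lower := le_of_mul_le_mul_left lower hm'
  have h3 : 3 * N / n = 3 * (N / n) := by ring
  have : 0 ≤ N / n := by positivity
  rw [abs_le]
  constructor <;> linarith

lemma abs_exp_neg_sub_le {x : ℝ} (hx0 : 0 ≤ x) (hx1 : x ≤ 1) :
    |Real.exp (-x) - (1 - x)| ≤ x ^ 2 := by
  have h := Real.abs_exp_sub_one_sub_id_le (x := -x) (by rwa [abs_neg, abs_of_nonneg hx0])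
  rwa [neg_sq, show Real.exp (-x) - 1 - -x = Real.exp (-x) - (1 - x) by ring] at h

/-- The probability that none of the first `k` guesses is correct is close to `e^{-k/n}`. -/
lemma abs_noHitBefore_density_sub_exp_le {m n : ℕ} (hm : 0 < m) (hn : 2 ≤ n) {k : ℕ}
    (hk : k ≤ m * n) :
    |((noHitBefore m n k).card : ℝ) / (DeckSet m n).card - Real.exp (-(k : ℝ) / n)| ≤
      4 * k / (n : ℝ) ^ 2 := by
  have hn' : (2 : ℝ) ≤ n := by exact_mod_cast hn
  have hN : (0 : ℝ) < (DeckSet m n).card := by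
    exact_mod_cast card_pos.2 ⟨_, modNat_mem_DeckSet m n⟩
  induction k with
  | zero => simp [noHitBefore, hN.ne']
  | succ k ih =>
    have ih := ih (by omega)
    have hcard := card_noHitBefore (⟨k, hk⟩ : Fin (m * n))
    have hstep := abs_card_noHitBefore_sub_le hm hn (⟨k, hk⟩ : Fin (m * n))
    dsimp only at hcard hstep
    set a := ((noHitBefore m n k).filter fun π => π ⟨k, hk⟩ = Fin.modNat ⟨k, hk⟩).card
    set N : ℝ := ((DeckSet m n).card : ℝ)
    set p : ℝ := ((noHitBefore m n k).card : ℝ) / N with hp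
    set q : ℝ := Real.exp (-(k : ℝ) / n) with hq
    have hq1 : q ≤ 1 := Real.exp_le_one_iff.2 (by
      rw [neg_div]; exact neg_nonpos.2 (by positivity))
    have hexp : Real.exp (-((k + 1 : ℕ) : ℝ) / n) = q * Real.exp (-(1 / n)) := by
      rw [hq, ← Real.exp_add]
      congr 1
      push_cast
      ring
    have hp1 : ((noHitBefore m n (k + 1)).card : ℝ) / N = p - a / N := by
      rw [hp, hcard]
      push_cast
      ring
    have hpa : |p / n - a / N| ≤ 3 / n ^ 2 := by
      have : p / n - a / N = (((noHitBefore m n k).card : ℝ) - n * a) / (n * N) := by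
        rw [hp]
        field_simp
      rw [this, abs_div, abs_of_pos (show 0 < n * N by positivity), div_le_iff₀ (by positivity)]
      refine hstep.trans_eq ?_
      field_simp
    have he := abs_exp_neg_sub_le (x := 1 / (n : ℝ)) (by positivity)
      (by rw [div_le_one (by positivity)]; linarith)
    have hqe : |q * ((1 - 1 / n) - Real.exp (-(1 / n)))| ≤ 1 / n ^ 2 := by
      rw [abs_mul, abs_sub_comm, abs_of_pos (Real.exp_pos _)]
      calc q * _ ≤ 1 * (1 / (n : ℝ)) ^ 2 := by gcongr
        _ = 1 / n ^ 2 := by ring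
    have hpq : |(p - q) * (1 - 1 / n)| ≤ 4 * k / n ^ 2 := by
      have h1 : 1 / (n : ℝ) ≤ 1 := by rw [div_le_one (by positivity)]; linarith
      have h2 : 0 ≤ 1 / (n : ℝ) := by positivity
      rw [abs_mul, abs_of_nonneg (show 0 ≤ 1 - 1 / (n : ℝ) by linarith)]
      exact (mul_le_of_le_one_right (abs_nonneg _) (by linarith)).trans ih
    rw [hexp, hp1, show p - a / N - q * Real.exp (-(1 / n)) = (p - q) * (1 - 1 / n) +
      (p / n - a / N) + q * ((1 - 1 / n) - Real.exp (-(1 / n))) by ring]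
    refine (abs_add_three _ _ _).trans ((add_le_add (add_le_add hpq hpa) hqe).trans_eq ?_)
    push_cast
    ring

lemma abs_firstHit_density_sub_le {m n : ℕ} (hm : 0 < m) (hn : 2 ≤ n) (K : Fin (m * n)) :
    |(((DeckSet m n).filter fun π => firstHit m n π = K.1 + 1).card : ℝ) / (DeckSet m n).card -
      Real.exp (-((K.1 + 1 : ℕ) : ℝ) / n) / n| ≤ (4 * m + 4) / (n : ℝ) ^ 2 := by
  have hn' : (2 : ℝ) ≤ n := by exact_mod_cast hn
  have hN : (0 : ℝ) < (DeckSet m n).card := by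
    exact_mod_cast card_pos.2 ⟨_, modNat_mem_DeckSet m n⟩
  have hstep := abs_card_noHitBefore_sub_le hm hn K
  have hd := abs_noHitBefore_density_sub_exp_le hm hn K.2.le
  rw [filter_firstHit_eq_succ]
  set a := ((noHitBefore m n K).filter fun π => π K = K.modNat).card
  set N : ℝ := ((DeckSet m n).card : ℝ)
  set p : ℝ := ((noHitBefore m n K).card : ℝ) / N with hp
  set q : ℝ := Real.exp (-(K.1 : ℝ) / n) with hq
  have hq1 : q ≤ 1 := Real.exp_le_one_iff.2 (by
    rw [neg_div]; exact neg_nonpos.2 (by positivity))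
  have hexp : Real.exp (-((K.1 + 1 : ℕ) : ℝ) / n) = q * Real.exp (-(1 / n)) := by
    rw [hq, ← Real.exp_add]
    congr 1
    push_cast
    ring
  have hpa : |a / N - p / n| ≤ 3 / n ^ 2 := by
    have : p / n - a / N = (((noHitBefore m n K).card : ℝ) - n * a) / (n * N) := by
      rw [hp]
      field_simp
    rw [abs_sub_comm, this, abs_div, abs_of_pos (show 0 < n * N by positivity),
      div_le_iff₀ (by positivity)]
    refine hstep.trans_eq ?_
    field_simp
  have hpq : |(p - q) / n| ≤ 4 * m / n ^ 2 := by
    rw [abs_div, abs_of_pos (show (0 : ℝ) < n by positivity), div_le_iff₀ (by positivity)]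
    refine hd.trans ?_
    rw [div_le_iff₀ (by positivity)]
    have : (K.1 : ℝ) ≤ m * n := by exact_mod_cast K.2.le
    field_simp
    linarith
  have hqe : |q * (1 - Real.exp (-(1 / n))) / n| ≤ 1 / n ^ 2 := by
    have h1 : Real.exp (-(1 / (n : ℝ))) ≤ 1 := Real.exp_le_one_iff.2 (neg_nonpos.2 (by positivity))
    have h2 := Real.add_one_le_exp (-(1 / (n : ℝ)))
    have h3 : 0 ≤ 1 - Real.exp (-(1 / (n : ℝ))) := by linarith
    rw [abs_of_nonneg (by positivity)]
    calc q * (1 - Real.exp (-(1 / n))) / n ≤ 1 * (1 / n) / (n : ℝ) := by gcongr; linarith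
      _ = 1 / n ^ 2 := by ring
  rw [hexp, show a / N - q * Real.exp (-(1 / n)) / n = (a / N - p / n) + (p - q) / n +
    q * (1 - Real.exp (-(1 / n))) / n by ring]
  refine (abs_add_three _ _ _).trans ((add_le_add (add_le_add hpa hpq) hqe).trans_eq ?_)
  ring

/-- Fix `m ≥ 1`.  For every `ε > 0` there is a constant `C` such that for every `n ≥ 1`
and every `1 ≤ k ≤ mn`, the probability that the first correct guess of the avoiding
strategy occurs at position `k` satisfies
`|Pr[f(π̄) = k] - e^{-k/n}/n| ≤ ε/n + C/n²`. -/
theorem firstHit_distribution (m : ℕ) (hm : 0 < m) (ε : ℝ) (hε : 0 < ε) :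
    ∃ C : ℝ, ∀ n : ℕ, 0 < n → ∀ k : ℕ, 1 ≤ k → k ≤ m * n →
      |(((DeckSet m n).filter fun π => firstHit m n π = k).card : ℝ) / (DeckSet m n).card -
          Real.exp (-(k : ℝ) / n) / n| ≤ ε / n + C / (n : ℝ) ^ 2 := by
  refine ⟨4 * m + 4, fun n hn k hk1 hk => ?_⟩
  have hεn : 0 ≤ ε / n := by positivity
  obtain rfl | hn2 : n = 1 ∨ 2 ≤ n := by omega
  · have hp1 : (((DeckSet m 1).filter fun π => firstHit m 1 π = k).card : ℝ) /
        (DeckSet m 1).card ≤ 1 :=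
      div_le_one_of_le₀ (by exact_mod_cast card_filter_le _ _) (by positivity)
    have hp0 : 0 ≤ (((DeckSet m 1).filter fun π => firstHit m 1 π = k).card : ℝ) /
        (DeckSet m 1).card := by positivity
    have hq0 := Real.exp_pos (-(k : ℝ))
    have hq1 : Real.exp (-(k : ℝ)) ≤ 1 := Real.exp_le_one_iff.2 (by simp)
    have hm0 : (0 : ℝ) ≤ m := Nat.cast_nonneg m
    simp only [Nat.cast_one, div_one, one_pow] at hεn ⊢
    rw [abs_le]
    constructor <;> linarith
  · obtain ⟨j, rfl⟩ : ∃ j, k = j + 1 := ⟨k - 1, by omega⟩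
    have := abs_firstHit_density_sub_le hm hn2 (⟨j, hk⟩ : Fin (m * n))
    dsimp only at this
    linarith
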